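/- Let R ⊆ S be convex and measurable, let x_0 ∈ R, and let X be a random point of S with density f. Define R' := {x ∈ R : ‖x − x_0‖ < ‖x − X‖}. Then there exists δ > 0, depending only on d and on the ratio inf_{x∈S} f(x) / sup_{x∈S} f(x) (and not on R or x_0), such that E[|R'| | X ∈ R] ≤ (1 − δ)|R|, where |·| denotes d-dimensional Lebesgue measure. In fact one may take δ = 2^{−2d} λ_0/λ_1 where λ_0 = inf_{x∈S} f(x) and λ_1 = sup_{x∈S} f(x). -/

import Mathlib

open MeasureTheory ProbabilityTheory

/-- The closed orthant pattern of `x` relative to the base point `x₀`. -/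
def orthantPattern {d : ℕ} (x₀ x : EuclideanSpace ℝ (Fin d)) : Fin d → Prop :=
  fun i => x₀ i ≤ x i

theorem measurable_orthantPattern {d : ℕ} (x₀ : EuclideanSpace ℝ (Fin d)) :
    Measurable (orthantPattern x₀) := by
  refine measurable_pi_iff.2 fun i => measurableSet_setOfPred.1 ?_
  exact measurableSet_le measurable_const (by fun_prop)

theorem inner_sub_nonneg_of_orthantPattern_eq {d : ℕ} {x₀ y z : EuclideanSpace ℝ (Fin d)}
    (h : orthantPattern x₀ z = orthantPattern x₀ y) :
    0 ≤ inner ℝ (y - x₀) (z - x₀) := by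
  rw [PiLp.inner_apply]
  refine Finset.sum_nonneg fun i _ => ?_
  have hi : (x₀ i ≤ z i) = (x₀ i ≤ y i) := congrFun h i
  simp only [PiLp.sub_apply, RCLike.inner_apply, conj_trivial]
  by_cases hy : x₀ i ≤ y i
  · have hz : x₀ i ≤ z i := hi ▸ hy
    exact mul_nonneg (sub_nonneg.2 hz) (sub_nonneg.2 hy)
  · have hz : ¬ x₀ i ≤ z i := hi ▸ hy
    exact mul_nonneg_of_nonpos_of_nonpos (by linarith) (by linarith)

theorem dist_homothety_half_le {E : Type*} [NormedAddCommGroup E] [InnerProductSpace ℝ E]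
    {x₀ y z : E} (h : 0 ≤ inner ℝ (y - x₀) (z - x₀)) :
    dist (AffineMap.homothety y (2⁻¹ : ℝ) z) y ≤ dist (AffineMap.homothety y (2⁻¹ : ℝ) z) x₀ := by
  have h₁ : AffineMap.homothety y (2⁻¹ : ℝ) z - y = (2⁻¹ : ℝ) • ((z - x₀) - (y - x₀)) := by
    simp only [AffineMap.homothety_apply, vsub_eq_sub, vadd_eq_add]
    module
  have h₂ : AffineMap.homothety y (2⁻¹ : ℝ) z - x₀ = (2⁻¹ : ℝ) • ((z - x₀) + (y - x₀)) := by
    simp only [AffineMap.homothety_apply, vsub_eq_sub, vadd_eq_add]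
    module
  rw [dist_eq_norm, dist_eq_norm, h₁, h₂, norm_smul, norm_smul]
  refine mul_le_mul_of_nonneg_left ?_ (norm_nonneg _)
  rw [← sq_le_sq₀ (norm_nonneg _) (norm_nonneg _)]
  rw [norm_sub_sq_real, norm_add_sq_real, real_inner_comm]
  linarith

theorem measureReal_closer_le {d : ℕ} {R : Set (EuclideanSpace ℝ (Fin d))}
    (hR : Convex ℝ R) (hR_meas : MeasurableSet R) (hR_fin : volume R ≠ ⊤)
    {x₀ y : EuclideanSpace ℝ (Fin d)} (hy : y ∈ R) :
    volume.real {x | x ∈ R ∧ dist x x₀ < dist x y} ≤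
      volume.real R - (2⁻¹ : ℝ) ^ d *
        volume.real (R ∩ orthantPattern x₀ ⁻¹' {orthantPattern x₀ y}) := by
  set A := {x | x ∈ R ∧ dist x x₀ < dist x y}
  set Q := R ∩ orthantPattern x₀ ⁻¹' {orthantPattern x₀ y}
  have hA : MeasurableSet A :=
    hR_meas.inter (measurableSet_lt (measurable_id.dist measurable_const)
      (measurable_id.dist measurable_const))
  have hsub : AffineMap.homothety y (2⁻¹ : ℝ) '' Q ⊆ R \ A := by
    rintro _ ⟨z, ⟨hz, hzy⟩, rfl⟩
    refine ⟨?_, fun h => ?_⟩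
    · rw [AffineMap.homothety_eq_lineMap]
      exact hR.lineMap_mem hy hz ⟨by norm_num, by norm_num⟩
    · exact absurd h.2 (not_lt.2
        (dist_homothety_half_le (inner_sub_nonneg_of_orthantPattern_eq hzy)))
  have hvol : volume.real (AffineMap.homothety y (2⁻¹ : ℝ) '' Q) =
      (2⁻¹ : ℝ) ^ d * volume.real Q := by
    rw [Measure.real, Measure.addHaar_image_homothety, ENNReal.toReal_mul,
      ENNReal.toReal_ofReal (abs_nonneg _), finrank_euclideanSpace_fin,
      abs_of_nonneg (by positivity)]
    rfl
  have hAR : A ⊆ R := fun x hx => And.left hx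
  have hle := measureReal_mono (μ := volume) hsub
    (measure_ne_top_of_subset Set.sdiff_subset hR_fin)
  have hdiff := measureReal_sdiff (μ := volume) (s₁ := R) (s₂ := A) hAR hA
    hR_fin
  linarith

theorem withDensity_real_bounds {α : Type*} [MeasurableSpace α] {μ : Measure α} {f : α → ℝ}
    {S T : Set α} {lo hi : ℝ} (hlo : 0 ≤ lo) (hhi : 0 ≤ hi)
    (hfl : ∀ x ∈ S, lo ≤ f x) (hfu : ∀ x ∈ S, f x ≤ hi)
    (hTS : T ⊆ S) (hT : MeasurableSet T) (hT_fin : μ T ≠ ⊤) :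
    lo * μ.real T ≤ (μ.withDensity fun x => ENNReal.ofReal (f x)).real T ∧
      (μ.withDensity fun x => ENNReal.ofReal (f x)).real T ≤ hi * μ.real T := by
  have hl : ENNReal.ofReal lo * μ T ≤ (μ.withDensity fun x => ENNReal.ofReal (f x)) T := by
    rw [withDensity_apply _ hT, ← setLIntegral_const]
    exact setLIntegral_mono' hT fun x hx => ENNReal.ofReal_le_ofReal (hfl x (hTS hx))
  have hu : (μ.withDensity fun x => ENNReal.ofReal (f x)) T ≤ ENNReal.ofReal hi * μ T := by
    rw [withDensity_apply _ hT, ← setLIntegral_const]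
    exact setLIntegral_mono' hT fun x hx => ENNReal.ofReal_le_ofReal (hfu x (hTS hx))
  have hfin : ENNReal.ofReal hi * μ T ≠ ⊤ := ENNReal.mul_ne_top ENNReal.ofReal_ne_top hT_fin
  constructor
  · have := ENNReal.toReal_mono (ne_top_of_le_ne_top hfin hu) hl
    rwa [ENNReal.toReal_mul, ENNReal.toReal_ofReal hlo] at this
  · have := ENNReal.toReal_mono hfin hu
    rwa [ENNReal.toReal_mul, ENNReal.toReal_ofReal hhi] at this

/-- Lemma 6.1 ("shrink"): let `R ⊆ S` be convex and measurable, `x₀ ∈ R`, and let `X` be a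
random point of `S` with density `f` bounded between `λ₀ > 0` and `λ₁` on `S`.  With
`R' = {x ∈ R : ‖x − x₀‖ < ‖x − X‖}`, one has
`E[|R'| ∣ X ∈ R] ≤ (1 − δ)|R|` for `δ = 2^{−2d} λ₀/λ₁ > 0`, a constant depending only on
`d` and the ratio `λ₀/λ₁` (not on `R` or `x₀`). -/
theorem stmt9 {d : ℕ} (hd : 1 ≤ d)
    {Ω : Type*} [MeasurableSpace Ω] (P : Measure Ω) [IsProbabilityMeasure P]
    (S : Set (EuclideanSpace ℝ (Fin d)))
    (hS_compact : IsCompact S) (hS_convex : Convex ℝ S) (hS_pos : 0 < volume S)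
    (f : EuclideanSpace ℝ (Fin d) → ℝ)
    (hf_meas : Measurable f)
    (hf_supp : ∀ x, x ∉ S → f x = 0)
    (lam₀ lam₁ : ℝ) (hlam₀ : 0 < lam₀) (hlam₀₁ : lam₀ ≤ lam₁)
    (hfl : ∀ x ∈ S, lam₀ ≤ f x) (hfu : ∀ x ∈ S, f x ≤ lam₁)
    (X : Ω → EuclideanSpace ℝ (Fin d))
    (hX_meas : Measurable X)
    (hX_law : Measure.map X P = volume.withDensity (fun x => ENNReal.ofReal (f x)))
    (R : Set (EuclideanSpace ℝ (Fin d)))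
    (hRS : R ⊆ S) (hR_convex : Convex ℝ R) (hR_meas : MeasurableSet R)
    (x₀ : EuclideanSpace ℝ (Fin d)) (hx₀ : x₀ ∈ R) :
    ∃ δ : ℝ, δ = (2 : ℝ) ^ (-(2 * (d : ℤ))) * lam₀ / lam₁ ∧ 0 < δ ∧
      ∫ ω, (volume {x | x ∈ R ∧ dist x x₀ < dist x (X ω)}).toReal
          ∂(P[|{ω | X ω ∈ R}])
        ≤ (1 - δ) * (volume R).toReal := by
  have hlam₁ : 0 < lam₁ := hlam₀.trans_le hlam₀₁
  refine ⟨_, rfl, by positivity, ?_⟩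
  have hR_fin : volume R ≠ ⊤ := measure_ne_top_of_subset hRS hS_compact.measure_lt_top.ne
  have hlaw : ∀ T ⊆ R, MeasurableSet T → lam₀ * volume.real T ≤ P.real (X ⁻¹' T) ∧
      P.real (X ⁻¹' T) ≤ lam₁ * volume.real T := by
    intro T hTR hT
    have := withDensity_real_bounds hlam₀.le hlam₁.le hfl hfu (hTR.trans hRS) hT
      (measure_ne_top_of_subset hTR hR_fin)
    rwa [← hX_law, map_measureReal_apply hX_meas hT] at this
  change ∫ ω, volume.real {x | x ∈ R ∧ dist x x₀ < dist x (X ω)} ∂(P[|X ⁻¹' R])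
    ≤ _ * volume.real R
  rcases (measureReal_nonneg (μ := volume) (s := R)).eq_or_lt with h0 | hpos
  · have hP : P (X ⁻¹' R) = 0 := by
      refine (measureReal_eq_zero_iff).1 (le_antisymm ?_ measureReal_nonneg)
      simpa [← h0] using (hlaw R subset_rfl hR_meas).2
    rw [cond_eq_zero_of_meas_eq_zero hP, integral_zero_measure, ← h0, mul_zero]
  obtain ⟨hPl, hPu⟩ := hlaw R subset_rfl hR_meas
  have hPpos : 0 < P.real (X ⁻¹' R) := (mul_pos hlam₀ hpos).trans_le hPl
  have hP0 : P (X ⁻¹' R) ≠ 0 := fun h => hPpos.ne' (by simp [Measure.real, h])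
  have hXR : MeasurableSet (X ⁻¹' R) := hX_meas hR_meas
  have : IsProbabilityMeasure (P[|X ⁻¹' R]) := cond_isProbabilityMeasure hP0
  have hσ := measurable_orthantPattern x₀
  set Q : (Fin d → Prop) → Set (EuclideanSpace ℝ (Fin d)) :=
    fun s => R ∩ orthantPattern x₀ ⁻¹' {s} with hQ
  have hQ_meas : ∀ s, MeasurableSet (Q s) := fun s =>
    hR_meas.inter (hσ (measurableSet_singleton s))
  have hsum : ∑ s, volume.real (Q s) = volume.real R := by
    rw [← measureReal_biUnion_finset (fun s _ t _ hst => ?_) (fun s _ => hQ_meas s)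
      (fun s _ => measure_ne_top_of_subset Set.inter_subset_left hR_fin)]
    · congr 1
      ext x
      simp [hQ]
    · exact Set.disjoint_left.2 fun x hs ht => hst (hs.2.symm.trans ht.2)
  have hcs : volume.real R ^ 2 ≤ 2 ^ d * ∑ s, volume.real (Q s) ^ 2 := by
    have := sq_sum_le_card_mul_sum_sq (s := Finset.univ) (f := fun s => volume.real (Q s))
    rw [hsum, Finset.card_univ] at this
    simpa using this
  have hcond : ∀ s, lam₀ * volume.real (Q s) / (lam₁ * volume.real R) ≤
      (P[|X ⁻¹' R]).real (X ⁻¹' Q s) := by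
    intro s
    have heq : X ⁻¹' R ∩ X ⁻¹' Q s = X ⁻¹' Q s :=
      Set.inter_eq_right.2 (Set.preimage_mono Set.inter_subset_left)
    rw [measureReal_def (P[|X ⁻¹' R]), cond_apply hXR, heq, ENNReal.toReal_mul, ENNReal.toReal_inv,
      inv_mul_eq_div]
    exact div_le_div₀ measureReal_nonneg (hlaw _ Set.inter_subset_left (hQ_meas s)).1 hPpos hPu
  have hint : ∀ s ∈ Finset.univ, Integrable
      (fun ω => (X ⁻¹' Q s).indicator (fun _ => volume.real (Q s)) ω) (P[|X ⁻¹' R]) :=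
    fun s _ => (integrable_const _).indicator (hX_meas (hQ_meas s))
  have hint' := (integrable_finsetSum _ hint).const_mul ((2⁻¹ : ℝ) ^ d)
  calc ∫ ω, volume.real {x | x ∈ R ∧ dist x x₀ < dist x (X ω)} ∂(P[|X ⁻¹' R])
      ≤ ∫ ω, (volume.real R - (2⁻¹ : ℝ) ^ d *
          ∑ s, (X ⁻¹' Q s).indicator (fun _ => volume.real (Q s)) ω) ∂(P[|X ⁻¹' R]) := by
        refine integral_mono_of_nonneg (.of_forall fun ω => measureReal_nonneg)
          ((integrable_const _).sub hint') ?_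
        filter_upwards [ae_cond_mem hXR] with ω hω
        have hval : ∑ s, (X ⁻¹' Q s).indicator (fun _ => volume.real (Q s)) ω =
            volume.real (Q (orthantPattern x₀ (X ω))) := by
          rw [Finset.sum_eq_single (orthantPattern x₀ (X ω))]
          · exact Set.indicator_of_mem
              (show ω ∈ X ⁻¹' Q (orthantPattern x₀ (X ω)) from ⟨hω, rfl⟩) _
          · exact fun s _ hs => Set.indicator_of_notMem (fun h => hs h.2.symm) _
          · simp
        rw [hval]
        exact measureReal_closer_le hR_convex hR_meas hR_fin hω
    _ = volume.real R - (2⁻¹ : ℝ) ^ d *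
          ∑ s, (P[|X ⁻¹' R]).real (X ⁻¹' Q s) * volume.real (Q s) := by
        rw [integral_sub (integrable_const _) hint', integral_const_mul,
          integral_finsetSum _ hint]
        simp [integral_indicator_const _ (hX_meas (hQ_meas _))]
    _ ≤ volume.real R - (2⁻¹ : ℝ) ^ d *
          ∑ s, lam₀ * volume.real (Q s) / (lam₁ * volume.real R) * volume.real (Q s) := by
        gcongr with s
        exact hcond s
    _ = volume.real R - (2⁻¹ : ℝ) ^ d * (lam₀ / (lam₁ * volume.real R)) *
          ∑ s, volume.real (Q s) ^ 2 := by
        rw [mul_assoc, Finset.mul_sum (a := lam₀ / _)]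
        congr 3
        ext s
        ring
    _ ≤ volume.real R - (2⁻¹ : ℝ) ^ d * (lam₀ / (lam₁ * volume.real R)) *
          ((2⁻¹ : ℝ) ^ d * volume.real R ^ 2) := by
        gcongr
        rw [inv_pow, inv_mul_le_iff₀ (by positivity)]
        exact hcs
    _ = (1 - (2 : ℝ) ^ (-(2 * (d : ℤ))) * lam₀ / lam₁) * volume.real R := by
        have hpow : (2 : ℝ) ^ (-(2 * (d : ℤ))) = (2⁻¹ : ℝ) ^ d * (2⁻¹ : ℝ) ^ d := by
          rw [← pow_add, inv_pow, zpow_neg, ← zpow_natCast]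
          push_cast
          rw [two_mul]
        rw [hpow]
        field_simp
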